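/- Let 𝕂 be ℝ or ℂ, let U be an open neighborhood of 0 in 𝕂ⁿ, and let f₁, …, f_p be analytic on U, each not identically zero near 0, with orders m_i, initial forms (f_i)_{m_i} and next homogeneous components (f_i)_{m_i+1}. Let X = {x ∈ U : f₁(x) = ⋯ = f_p(x) = 0}. Let u ∈ 𝕂ⁿ \ {0} be such that the p vectors ∇(f_1)_{m_1}(u), …, ∇(f_p)_{m_p}(u) are linearly independent, and let w ∈ 𝕂ⁿ satisfy, for every i = 1, …, p, (f_i)_{m_i}(u) = 0 and (1/2)⟨∇(f_i)_{m_i}(u), w⟩ + (f_i)_{m_i+1}(u) = 0. Then there exist ε > 0 and an analytic curve γ on {t : |t| < ε} with γ(t) ∈ X for all |t| < ε and γ(t) = t u + (1/2) t² w + O(t³) as t → 0; in particular w ∈ T²_{0,u}X. -/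

import Mathlib

open Filter Topology Asymptotics

/-- Admissible parameter values `t` for limits `t → 0`: nonzero, and positive
when `𝕂 = ℝ` (detected by `RCLike.I = 0`). -/
def Adm {K : Type*} [RCLike K] (t : K) : Prop :=
  t ≠ 0 ∧ ((RCLike.I : K) = 0 → 0 < RCLike.re t)

/-- The geometric directional second-order tangent set `T²_{p,u} X`. -/
def secondTangentSet {K : Type*} [RCLike K] {n : ℕ}
    (X : Set (Fin n → K)) (p u : Fin n → K) : Set (Fin n → K) :=
  {w | ∃ t : ℕ → K, ∃ W : ℕ → (Fin n → K),
    (∀ k, Adm (t k)) ∧ Tendsto t atTop (𝓝 0) ∧ Tendsto W atTop (𝓝 w) ∧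
    ∀ k, p + t k • u + ((1 / 2 : K) * t k ^ 2) • W k ∈ X}

/-- The gradient vector `∇g(u) = (∂g/∂x₁(u), …, ∂g/∂xₙ(u))`. -/
noncomputable def grad {K : Type*} [RCLike K] {n : ℕ}
    (g : (Fin n → K) → K) (u : Fin n → K) : Fin n → K :=
  fun j => fderiv K g u (Pi.single j 1)

/-- The bilinear pairing `⟨a, b⟩ = ∑ i, aᵢ bᵢ`. -/
def pair {K : Type*} [RCLike K] {n : ℕ} (a b : Fin n → K) : K :=
  ∑ j, a j * b j

open scoped Matrix

universe u

theorem pair_grad {K : Type*} [RCLike K] {n : ℕ} (g : (Fin n → K) → K) (u v : Fin n → K) :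
    pair (grad g u) v = fderiv K g u v := by
  conv_rhs => rw [pi_eq_sum_univ' v, map_sum]
  refine Finset.sum_congr rfl fun j _ => ?_
  rw [map_smul, smul_eq_mul, mul_comm]
  rfl

theorem exists_rightInverse_pair {K : Type*} [RCLike K] {n p : ℕ} (a : Fin p → Fin n → K)
    (ha : LinearIndependent K a) :
    ∃ A : (Fin p → K) →L[K] (Fin n → K), ∀ s i, pair (a i) (A s) = s i := by
  have hrank : (Matrix.of a).rank = Fintype.card (Fin p) := ha.rank_matrix
  have hsurj : Function.Surjective (Matrix.of a).mulVec := by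
    have : LinearMap.range (Matrix.of a).mulVecLin = ⊤ := by
      apply Submodule.eq_top_of_finrank_eq
      rw [Module.finrank_pi]
      exact hrank
    exact LinearMap.range_eq_top.1 this
  obtain ⟨B, hB⟩ := Matrix.mulVec_surjective_iff_exists_right_inverse.1 hsurj
  refine ⟨LinearMap.toContinuousLinearMap B.mulVecLin, fun s i => ?_⟩
  have h : Matrix.of a *ᵥ (B *ᵥ s) = s := by rw [Matrix.mulVec_mulVec, hB, Matrix.one_mulVec]
  exact congrFun h i

/-- Hadamard's lemma for analytic functions: `f x = f 0 + g x x` with `g` analytic. -/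
theorem HasFPowerSeriesAt.exists_hasFPowerSeriesAt_shift {K : Type*} [RCLike K]
    {E F : Type*} [NormedAddCommGroup E] [NormedSpace K E]
    [NormedAddCommGroup F] [NormedSpace K F] [CompleteSpace F] {f : E → F}
    {P : FormalMultilinearSeries K E F} (hf : HasFPowerSeriesAt f P 0) :
    ∃ g : E → E →L[K] F, HasFPowerSeriesAt g P.shift 0 ∧ ∀ᶠ x in 𝓝 0, f x = f 0 + g x x := by
  obtain ⟨r, hr⟩ := hf
  have hg : HasFPowerSeriesOnBall P.shift.sum P.shift 0 r := by
    have h := P.shift.hasFPowerSeriesOnBall (by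
      rw [FormalMultilinearSeries.radius_shift]; exact hr.r_pos.trans_le hr.r_le)
    exact h.mono hr.r_pos (by rw [FormalMultilinearSeries.radius_shift]; exact hr.r_le)
  have hP : P.shift.unshift (f 0) = P := by
    ext1 k
    cases k with
    | zero =>
      ext v
      exact (hr.hasFPowerSeriesAt.coeff_zero v).symm
    | succ k => exact (continuousMultilinearCurryRightEquiv' K k E F).symm_apply_apply (P (k + 1))
  refine ⟨_, hg.hasFPowerSeriesAt, ?_⟩
  have h := hg.unshift (z := f 0)
  rw [hP] at h
  filter_upwards [Metric.eball_mem_nhds (0 : E) hr.r_pos] with x hx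
  simpa using hr.unique h hx

/-- Weighted blow-up of an analytic function: modulo terms of degree `< m`, `f (t • y)` equals
`t ^ m` times an analytic function of `(t, y)`. -/
theorem HasFPowerSeriesAt.exists_analyticAt_blowup {K : Type*} [RCLike K]
    {E : Type u} [NormedAddCommGroup E] [NormedSpace K E] (u : E) (m : ℕ)
    {F : Type u} [NormedAddCommGroup F] [NormedSpace K F] [CompleteSpace F] {f : E → F}
    {P : FormalMultilinearSeries K E F} (hf : HasFPowerSeriesAt f P 0) :
    ∃ Φ : K × E → F, AnalyticAt K Φ (0, u) ∧
      (∀ᶠ q in 𝓝 ((0 : K), u), f (q.1 • q.2) =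
        ∑ j ∈ Finset.range m, q.1 ^ j • P j (fun _ => q.2) + q.1 ^ m • Φ q) ∧
      (∀ y, Φ (0, y) = P m fun _ => y) ∧
      HasDerivAt (fun t => Φ (t, u)) (P (m + 1) fun _ => u) 0 := by
  induction m generalizing F with
  | zero =>
    have hs : AnalyticAt K (fun q : K × E => q.1 • q.2) (0, u) := analyticAt_fst.smul analyticAt_snd
    refine ⟨fun q => f (q.1 • q.2), ?_, by simp, fun y => ?_, ?_⟩
    · refine AnalyticAt.fun_comp (g := f) ?_ hs
      simpa using hf.analyticAt
    · simpa using (hf.coeff_zero _).symm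
    · have h1 : HasDerivAt (fun t : K => t • u) u 0 := by
        simpa using (hasDerivAt_id (0 : K)).smul_const u
      have h2 : HasFDerivAt f (continuousMultilinearCurryFin1 K E F (P 1)) ((0 : K) • u) := by
        simpa using hf.hasFDerivAt
      have h3 := h2.comp_hasDerivAt (0 : K) h1
      convert! h3 using 1
  | succ m ih =>
    obtain ⟨g, hg, hfg⟩ := hf.exists_hasFPowerSeriesAt_shift
    obtain ⟨Φ, hΦ, heq, h0, hd⟩ := ih hg
    have hshift (k : ℕ) (y : E) : P.shift k (fun _ => y) y = P (k + 1) fun _ => y := by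
      change P (k + 1) (Fin.snoc (fun _ => y) y) = _
      congr 1
      ext i
      refine Fin.lastCases ?_ (fun j => ?_) i <;> simp
    refine ⟨fun q => Φ q q.2, ?_, ?_, fun y => ?_, ?_⟩
    · exact AnalyticAt.fun_comp (g := fun z : (E →L[K] F) × E => z.1 z.2)
        (ContinuousLinearMap.analyticAt_bilinear (ContinuousLinearMap.id K (E →L[K] F)) _)
        (hΦ.prod analyticAt_snd)
    · have ht : Tendsto (fun q : K × E => q.1 • q.2) (𝓝 (0, u)) (𝓝 0) := by
        have : Continuous fun q : K × E => q.1 • q.2 := by fun_prop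
        simpa using this.tendsto (0, u)
      filter_upwards [heq, ht.eventually hfg] with q hq1 hq2
      have hz : P 0 (fun _ => q.2) = f 0 := hf.coeff_zero _
      have hsum : (∑ j ∈ Finset.range m, q.1 ^ j • P.shift j fun _ => q.2) q.2 =
          ∑ j ∈ Finset.range m, q.1 ^ j • P (j + 1) fun _ => q.2 := by
        rw [sum_apply]
        exact Finset.sum_congr rfl fun j _ => congrArg (q.1 ^ j • ·) (hshift j q.2)
      rw [hq2, hq1, Finset.sum_range_succ', map_smul, add_apply, hsum]
      simp only [smul_apply, smul_add, Finset.smul_sum, smul_smul, hz,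
        pow_succ', pow_zero, one_smul]
      abel
    · simp only [h0, hshift]
    · have h := (ContinuousLinearMap.apply K F u).hasFDerivAt.comp_hasDerivAt (0 : K) hd
      convert! h using 1
      exact (hshift _ _).symm

/-- A special case of the analytic implicit function theorem. -/
theorem AnalyticAt.exists_implicit_curve {K : Type*} [RCLike K]
    {F : Type*} [NormedAddCommGroup F] [NormedSpace K F] [CompleteSpace F] {H : K × F → F}
    (hH : AnalyticAt K H 0) (hd : HasFDerivAt H (ContinuousLinearMap.snd K K F) 0)
    (h0 : H 0 = 0) :
    ∃ s : K → F, AnalyticAt K s 0 ∧ s 0 = 0 ∧ HasDerivAt s 0 0 ∧ ∀ᶠ t in 𝓝 0, H (t, s t) = 0 := by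
  have hΨ : ContDiffAt K ⊤ (fun q : K × F => (q.1, H q)) 0 :=
    contDiffAt_fst.prodMk hH.contDiffAt
  have hΨd : HasFDerivAt (fun q : K × F => (q.1, H q))
      (ContinuousLinearEquiv.refl K (K × F) : (K × F) →L[K] (K × F)) 0 := by
    exact (hasFDerivAt_fst.prodMk hd).congr_fderiv rfl
  have hstrict := hΨ.hasStrictFDerivAt' hΨd (by simp)
  set R := hΨ.localInverse hΨd (by simp)
  have hR0 : R 0 = 0 := by
    simpa [h0] using! hΨ.localInverse_apply_image hΨd (by simp)
  have hRa : AnalyticAt K R 0 := by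
    simpa [h0] using! (hΨ.to_localInverse hΨd (by simp)).analyticAt
  have hRd : HasFDerivAt R (ContinuousLinearMap.id K (K × F)) 0 := by
    simpa [h0] using! hstrict.to_localInverse.hasFDerivAt
  have hinv : ∀ᶠ y in 𝓝 (0 : K × F), ((R y).1, H (R y)) = y := by
    simpa [h0] using! hstrict.eventually_right_inverse
  have hι : HasDerivAt (fun t : K => (t, (0 : F))) (1, 0) 0 :=
    (hasDerivAt_id (0 : K)).prodMk (hasDerivAt_const _ _)
  have hιa : AnalyticAt K (fun t : K => (t, (0 : F))) 0 := analyticAt_id.prod analyticAt_const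
  refine ⟨fun t => (R (t, 0)).2, ?_, ?_, ?_, ?_⟩
  · exact AnalyticAt.fun_comp (g := Prod.snd) analyticAt_snd (AnalyticAt.fun_comp (g := R) hRa hιa)
  · change (R 0).2 = 0
    rw [hR0]; rfl
  · have h1 : HasDerivAt (fun t : K => R (t, 0)) (1, 0) 0 := by
      simpa using! HasFDerivAt.comp_hasDerivAt (f := fun t : K => (t, (0 : F))) (0 : K) hRd hι
    simpa using! (hasFDerivAt_snd (𝕜 := K) (p := R (0, 0))).comp_hasDerivAt (0 : K) h1
  · have := hι.continuousAt.tendsto.eventually hinv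
    filter_upwards [this] with t ht
    have h1 : (R (t, 0)).1 = t := congrArg Prod.fst ht
    have h2 : H (R (t, 0)) = 0 := congrArg Prod.snd ht
    have h3 : (t, (R (t, 0)).2) = R (t, 0) := Prod.ext h1.symm rfl
    simpa only [h3] using h2

theorem AnalyticAt.isBigO_sq {K : Type*} [RCLike K]
    {F : Type*} [NormedAddCommGroup F] [NormedSpace K F] {s : K → F}
    (hs : AnalyticAt K s 0) (h0 : s 0 = 0) (hd : HasDerivAt s 0 0) :
    s =O[𝓝 0] fun t => t ^ 2 := by
  obtain ⟨q, hq⟩ := hs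
  have h1 : q.coeff 1 = 0 := hq.hasDerivAt.unique hd
  have h := hq.isBigO_sub_partialSum_pow 2
  have hps (y : K) : q.partialSum 2 y = 0 := by
    have hq0 : q.coeff 0 = 0 := (hq.coeff_zero _).trans h0
    simp [FormalMultilinearSeries.partialSum, Finset.sum_range_succ, hq0, h1]
  simp only [hps, zero_add, sub_zero] at h
  exact h.trans (IsBigO.of_bound 1 (by simp))

/-- A parametrized curve with second-order expansion `t u + t² w / 2` inside `X` puts `w` in the
second-order tangent set. -/
theorem mem_secondTangentSet_of_curve {K : Type*} [RCLike K] {n : ℕ} {X : Set (Fin n → K)}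
    {u w : Fin n → K} {γ : K → Fin n → K} (hX : ∀ᶠ t in 𝓝 0, γ t ∈ X)
    (hγ : (fun t : K => γ t - (t • u + ((1 / 2 : K) * t ^ 2) • w)) =O[𝓝 (0 : K)]
      fun t : K => t ^ 3) :
    w ∈ secondTangentSet X 0 u := by
  obtain ⟨ε, hε, hball⟩ := Metric.eventually_nhds_iff.1 hX
  let r : ℕ → ℝ := fun k => ε / 2 * (1 / ((k : ℝ) + 1))
  let t : ℕ → K := fun k => (r k : K)
  have hr (k : ℕ) : 0 < r k := by positivity
  have ht0 (k : ℕ) : t k ≠ 0 := RCLike.ofReal_ne_zero.2 (hr k).ne'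
  have hrt : Tendsto r atTop (𝓝 0) := by
    simpa only [mul_zero] using tendsto_one_div_add_atTop_nhds_zero_nat.const_mul (ε / 2)
  have htt : Tendsto t atTop (𝓝 0) := by
    simpa using! ((RCLike.continuous_ofReal (K := K)).tendsto 0).comp hrt
  refine ⟨t, fun k => (2 * (t k ^ 2)⁻¹) • (γ (t k) - t k • u),
    fun k => ⟨ht0 k, fun _ => by simpa [t] using hr k⟩, htt, ?_, fun k => ?_⟩
  · have h1 := (isBigO_refl (fun k => 2 * (t k ^ 2)⁻¹) atTop).smul (hγ.comp_tendsto htt)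
    have h2 : Tendsto (fun k => (2 * (t k ^ 2)⁻¹) • t k ^ 3) atTop (𝓝 0) := by
      have : (fun k => (2 * (t k ^ 2)⁻¹) • t k ^ 3) = fun k => 2 * t k := by
        ext k
        have := ht0 k
        simp only [smul_eq_mul]
        field_simp
      rw [this]
      simpa using htt.const_mul 2
    have h3 := (h1.trans_tendsto h2).add_const w
    rw [zero_add] at h3
    refine h3.congr fun k => ?_
    have hc : 2 * (t k ^ 2)⁻¹ * ((1 / 2 : K) * t k ^ 2) = 1 := by
      have := ht0 k
      field_simp
    simp only [Function.comp, ← sub_sub, smul_sub _ _ (((1 / 2 : K) * t k ^ 2) • w), smul_smul, hc,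
      one_smul, sub_add_cancel]
  · have hc : (1 / 2 : K) * t k ^ 2 * (2 * (t k ^ 2)⁻¹) = 1 := by
      have := ht0 k
      field_simp
    rw [smul_smul, hc, one_smul, zero_add, add_sub_cancel]
    apply hball
    have h1 : 1 / ((k : ℝ) + 1) ≤ 1 := by
      rw [div_le_one (by positivity)]; linarith [(Nat.cast_nonneg k : (0 : ℝ) ≤ k)]
    have h2 : r k < ε := by
      calc r k ≤ ε / 2 * 1 := mul_le_mul_of_nonneg_left h1 (by positivity)
        _ < ε := by linarith
    simpa [t, abs_of_pos (hr k)] using h2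

/-- For an analytic set `X = {f₁ = ⋯ = f_p = 0}` that is nondegenerate
along `u` (the gradients of the initial forms at `u` are linearly independent) and any
`w` satisfying the algebraic second-order equations, there is an analytic curve in `X`
with `γ(t) = t u + (1/2) t² w + O(t³)`; in particular `w ∈ T²_{0,u} X`. -/
theorem stmt2 {K : Type*} [RCLike K] {n p : ℕ}
    (U : Set (Fin n → K)) (hUopen : IsOpen U) (hU0 : (0 : Fin n → K) ∈ U)
    (f : Fin p → (Fin n → K) → K) (hf : ∀ i, ∀ x ∈ U, AnalyticAt K (f i) x)
    (P : Fin p → FormalMultilinearSeries K (Fin n → K) K)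
    (hP : ∀ i, HasFPowerSeriesAt (f i) (P i) 0)
    (m : Fin p → ℕ)
    (fm fm1 : Fin p → (Fin n → K) → K)
    (hfm : ∀ i, fm i = fun x => P i (m i) (fun _ => x))
    (hfm1 : ∀ i, fm1 i = fun x => P i (m i + 1) (fun _ => x))
    (horder : ∀ i, ∀ j < m i, ∀ x, P i j (fun _ => x) = 0)
    (hfmne : ∀ i, fm i ≠ 0)
    (X : Set (Fin n → K)) (hX : X = {x ∈ U | ∀ i, f i x = 0})
    (u : Fin n → K) (hu : u ≠ 0)
    (hindep : LinearIndependent K (fun i : Fin p => grad (fm i) u))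
    (w : Fin n → K)
    (hw : ∀ i, fm i u = 0 ∧ (1 / 2 : K) * pair (grad (fm i) u) w + fm1 i u = 0) :
    ∃ ε > (0 : ℝ), ∃ γ : K → (Fin n → K),
      (∀ t : K, ‖t‖ < ε → AnalyticAt K γ t) ∧
      (∀ t : K, ‖t‖ < ε → γ t ∈ X) ∧
      (fun t : K => γ t - (t • u + ((1 / 2 : K) * t ^ 2) • w))
        =O[𝓝 (0 : K)] (fun t : K => t ^ 3) ∧
      w ∈ secondTangentSet X 0 u := by
  choose Φ hΦa hΦeq hΦ0 hΦd using fun i => (hP i).exists_analyticAt_blowup u (m i)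
  obtain ⟨A, hA⟩ := exists_rightInverse_pair _ hindep
  let y : K × (Fin p → K) → (Fin n → K) := fun q => u + ((1 / 2 : K) * q.1) • w + A q.2
  let Y : K × (Fin p → K) →L[K] (Fin n → K) :=
    ((1 / 2 : K) • ContinuousLinearMap.fst K K (Fin p → K)).smulRight w +
      A.comp (ContinuousLinearMap.snd K K (Fin p → K))
  have hyY : y = fun q => u + Y q := by
    ext q
    simp [y, Y, add_assoc]
  have hy0 : y 0 = u := by simp [hyY]
  have hya : AnalyticAt K y 0 := by
    rw [hyY]
    exact analyticAt_const.add (Y.analyticAt 0)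
  have hyd : HasFDerivAt y Y 0 := by
    rw [hyY]
    exact Y.hasFDerivAt.const_add u
  let H : K × (Fin p → K) → (Fin p → K) := fun q i => Φ i (q.1, y q)
  have hpaira : AnalyticAt K (fun q : K × (Fin p → K) => (q.1, y q)) 0 := analyticAt_fst.prod hya
  have hpaird : HasFDerivAt (fun q : K × (Fin p → K) => (q.1, y q))
      ((ContinuousLinearMap.fst K K (Fin p → K)).prod Y) 0 := hasFDerivAt_fst.prodMk hyd
  have hHa : AnalyticAt K H 0 := by
    refine AnalyticAt.pi fun i => ?_
    refine AnalyticAt.fun_comp (g := Φ i) ?_ hpaira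
    simpa [hy0] using hΦa i
  have hH0 : H 0 = 0 := by
    ext i
    have := (hw i).1
    simp only [hfm] at this
    simp [H, hy0, hΦ0, this]
  have hHd : HasFDerivAt H (ContinuousLinearMap.snd K K (Fin p → K)) 0 := by
    rw [hasFDerivAt_pi']
    intro i
    have hL : HasFDerivAt (Φ i) (fderiv K (Φ i) (0, u)) (0, u) :=
      (hΦa i).differentiableAt.hasFDerivAt
    have hL1 : fderiv K (Φ i) (0, u) (1, 0) = fm1 i u := by
      have h := hL.comp_hasDerivAt (0 : K) ((hasDerivAt_id (0 : K)).prodMk (hasDerivAt_const _ u))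
      rw [hfm1]
      exact h.unique (hΦd i)
    have hL2 (v : Fin n → K) : fderiv K (Φ i) (0, u) (0, v) = fderiv K (fm i) u v := by
      have h := hL.comp u ((hasFDerivAt_const (0 : K) u).prodMk (hasFDerivAt_id u))
      have he : fm i = Φ i ∘ fun v => (0, id v) := by
        ext v
        simp [hΦ0, hfm]
      rw [he]
      exact (DFunLike.congr_fun h.fderiv v).symm
    have h1 := HasFDerivAt.comp (g := Φ i) (0 : K × (Fin p → K)) (by simpa [hy0] using hL) hpaird
    refine h1.congr_fderiv ?_
    refine ContinuousLinearMap.ext fun ⟨t, s⟩ => ?_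
    have hsplit : (t, Y (t, s)) = t • ((1 : K), (0 : Fin n → K)) + (0, Y (t, s)) := by simp
    have hYts : Y (t, s) = ((1 / 2 : K) * t) • w + A s := by simp [Y]
    have hw2 := (hw i).2
    have hAs := hA s i
    rw [pair_grad] at hw2 hAs
    change fderiv K (Φ i) (0, u) (t, Y (t, s)) = s i
    rw [hsplit, map_add, map_smul, hL1, hL2, hYts, map_add, map_smul, hAs]
    simp only [smul_eq_mul]
    linear_combination t * hw2
  obtain ⟨s, hsa, hs0, hsd, hHs⟩ := hHa.exists_implicit_curve hHd hH0
  let γ : K → (Fin n → K) := fun t => t • y (t, s t)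
  have hysa : AnalyticAt K (fun t => y (t, s t)) 0 := by
    refine AnalyticAt.fun_comp (g := y) ?_ (analyticAt_id.prod hsa)
    simpa [hs0] using! hya
  have hγa : AnalyticAt K γ 0 := analyticAt_id.smul hysa
  have hγX : ∀ᶠ t in 𝓝 0, γ t ∈ X := by
    have hU : ∀ᶠ t in 𝓝 0, γ t ∈ U := by
      refine hγa.continuousAt.eventually_mem (hUopen.mem_nhds ?_)
      simpa [γ] using hU0
    have htend : Tendsto (fun t => (t, y (t, s t))) (𝓝 (0 : K)) (𝓝 (0, u)) := by
      have := (continuousAt_id.prodMk hysa.continuousAt).tendsto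
      have h0 : y (0, s 0) = u := by rw [hs0]; exact hy0
      simpa only [id, h0] using this
    have hev := htend.eventually (eventually_all.2 hΦeq)
    filter_upwards [hU, hev, hHs] with t htU hte htH
    rw [hX]
    refine ⟨htU, fun i => ?_⟩
    have hz : Φ i (t, y (t, s t)) = 0 := congrFun htH i
    rw [show f i (γ t) = _ from hte i, hz, smul_zero, add_zero]
    refine Finset.sum_eq_zero fun j hj => ?_
    rw [horder i j (Finset.mem_range.1 hj), smul_zero]
  have hγO : (fun t : K => γ t - (t • u + ((1 / 2 : K) * t ^ 2) • w))
      =O[𝓝 (0 : K)] fun t : K => t ^ 3 := by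
    have h := (isBigO_refl (fun t : K => t) (𝓝 0)).smul
      ((A.isBigO_comp s (𝓝 0)).trans (hsa.isBigO_sq hs0 hsd))
    refine (h.congr_left fun t => ?_).congr_right fun t => ?_
    · simp only [γ, y, smul_add, smul_smul]
      rw [show t * (1 / 2 * t) = 1 / 2 * t ^ 2 by ring]
      abel
    · simp only [smul_eq_mul]
      ring
  obtain ⟨ε, hε, hball⟩ := Metric.eventually_nhds_iff.1 (hγa.eventually_analyticAt.and hγX)
  exact ⟨ε, hε, γ, fun t ht => (hball (by simpa using ht)).1,
    fun t ht => (hball (by simpa using ht)).2, hγO, mem_secondTangentSet_of_curve hγX hγO⟩
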